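/- arXiv:2603.09158 — 3 statements merged into one kernel-verified Lean document; each statement's English description precedes it below -/
import Mathlib

section
/- Let 𝐗 = (X,𝕏) be a level-2 α-Hölder rough path over V, let 𝐘 = (Y,Y') be an 𝐗-controlled rough path with values in L(W,U) and let 𝐙 = (Z,Z') be an 𝐗-controlled rough path with values in W. Let P : s = t₀ < t₁ < ⋯ < t_n = t be a finite partition of [s,t] ⊆ [0,T] with n ≥ 2, let 1 ≤ j ≤ n−1, and let P∖{t_j} denote the partition obtained by removing the point t_j. Then one has the exact identity ∫_P Y dZ − ∫_{P∖{t_j}} Y dZ = R^{𝐘}_{t_{j−1},t_j}(R^{𝐙}_{t_j,t_{j+1}}) + R^{𝐘}_{t_{j−1},t_j}(Z'_{t_j}(X_{t_j,t_{j+1}})) + (Y'_{t_{j−1}}(X_{t_{j−1},t_j}))(R^{𝐙}_{t_j,t_{j+1}}) + (Y'_{t_{j−1}} ⋆ (Z'_{t_j} − Z'_{t_{j−1}}))(X_{t_{j−1},t_j} ⊗ X_{t_j,t_{j+1}}) + ((Y'_{t_j} ⋆ Z'_{t_j}) − (Y'_{t_{j−1}} ⋆ Z'_{t_{j−1}}))(𝕏_{t_j,t_{j+1}}).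 -/
/-!  Common definitions: level-2 rough paths, controlled rough paths,
compensated Riemann sums and rough integrals of a controlled rough path
against another controlled rough path. -/

open scoped BigOperators

noncomputable section

/-- `HBound T β A` : the two-parameter map `A` satisfies a `β`-Hölder bound on the
simplex `{0 ≤ s < t ≤ T}`. -/
def HBound {E : Type*} [NormedAddCommGroup E] (T β : ℝ) (A : ℝ → ℝ → E) : Prop :=
  ∃ C : ℝ, ∀ s t : ℝ, 0 ≤ s → s < t → t ≤ T → ‖A s t‖ ≤ C * (t - s) ^ β

/-- The Hölder seminorm `‖A‖_β = sup_{0 ≤ s < t ≤ T} ‖A_{s,t}‖ / (t-s)^β`, realised as the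
least admissible Hölder constant. -/
def hnorm {E : Type*} [NormedAddCommGroup E] (T β : ℝ) (A : ℝ → ℝ → E) : ℝ :=
  sInf {C : ℝ | 0 ≤ C ∧ ∀ s t : ℝ, 0 ≤ s → s < t → t ≤ T → ‖A s t‖ ≤ C * (t - s) ^ β}

/-- An abstract model of the projective tensor product `V ⊗̂ V`, bundling the canonical
bounded bilinear map `tmul : V × V → V ⊗̂ V` and the pairing `⋆` sending
`A ∈ L(V, L(W,U))` and `B ∈ L(V,W)` to the induced operator `A ⋆ B ∈ L(V ⊗̂ V, U)`,
characterised by `(A ⋆ B)(v₁ ⊗ v₂) = (A v₁)(B v₂)` and `‖A ⋆ B‖ ≤ ‖A‖ ‖B‖`. -/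
structure TensorOps (V V2 W U : Type*)
    [NormedAddCommGroup V] [NormedSpace ℝ V] [NormedAddCommGroup V2] [NormedSpace ℝ V2]
    [NormedAddCommGroup W] [NormedSpace ℝ W] [NormedAddCommGroup U] [NormedSpace ℝ U] where
  tmul : V →L[ℝ] V →L[ℝ] V2
  tmul_le : ∀ a b : V, ‖tmul a b‖ ≤ ‖a‖ * ‖b‖
  spair : (V →L[ℝ] (W →L[ℝ] U)) →L[ℝ] ((V →L[ℝ] W) →L[ℝ] (V2 →L[ℝ] U))
  spair_tmul : ∀ (A : V →L[ℝ] (W →L[ℝ] U)) (B : V →L[ℝ] W) (a b : V),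
    spair A B (tmul a b) = (A a) (B b)
  spair_le : ∀ (A : V →L[ℝ] (W →L[ℝ] U)) (B : V →L[ℝ] W), ‖spair A B‖ ≤ ‖A‖ * ‖B‖

section Defs

variable {V V2 E : Type*}
  [NormedAddCommGroup V] [NormedSpace ℝ V] [NormedAddCommGroup V2] [NormedSpace ℝ V2]
  [NormedAddCommGroup E] [NormedSpace ℝ E]

/-- `(X, XX)` is a level-2 `α`-Hölder rough path on `[0,T]`:
Chen's relation plus the analytic estimates. -/
structure IsRoughPath (T α : ℝ) (tmul : V →L[ℝ] V →L[ℝ] V2)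
    (X : ℝ → V) (XX : ℝ → ℝ → V2) : Prop where
  chen : ∀ s u t : ℝ, 0 ≤ s → s ≤ u → u ≤ t → t ≤ T →
    XX s t = XX s u + XX u t + tmul (X u - X s) (X t - X u)
  x_hold : HBound T α fun s t => X t - X s
  xx_hold : HBound T (2 * α) XX

/-- `‖𝐗‖_α := ‖X‖_α + ‖𝕏‖_{2α}`. -/
def rpNorm (T α : ℝ) (X : ℝ → V) (XX : ℝ → ℝ → V2) : ℝ :=
  hnorm T α (fun s t => X t - X s) + hnorm T (2 * α) XX

/-- `‖𝐗 − 𝐗̃‖_α := ‖X − X̃‖_α + ‖𝕏 − 𝕏̃‖_{2α}`. -/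
def rpDist (T α : ℝ) (X Xt : ℝ → V) (XX XXt : ℝ → ℝ → V2) : ℝ :=
  hnorm T α (fun s t => (X t - X s) - (Xt t - Xt s)) +
    hnorm T (2 * α) fun s t => XX s t - XXt s t

/-- The remainder `R^{𝐘}_{s,t} := Y_{s,t} − Y'_s(X_{s,t})` of a controlled rough path. -/
def Rem (X : ℝ → V) (Y : ℝ → E) (Y' : ℝ → V →L[ℝ] E) (s t : ℝ) : E :=
  Y t - Y s - Y' s (X t - X s)

/-- `(Y, Y')` is an `𝐗`-controlled rough path on `[0,T]` with values in `E`. -/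
structure IsCRP (T α : ℝ) (X : ℝ → V) (Y : ℝ → E) (Y' : ℝ → V →L[ℝ] E) : Prop where
  deriv_hold : HBound T α fun s t => Y' t - Y' s
  rem_hold : HBound T (2 * α) (Rem X Y Y')

/-- `‖𝐘‖_{𝐗;α} := ‖R^{𝐘}‖_{2α} + ‖Y'‖_α`. -/
def crpNorm (T α : ℝ) (X : ℝ → V) (Y : ℝ → E) (Y' : ℝ → V →L[ℝ] E) : ℝ :=
  hnorm T (2 * α) (Rem X Y Y') + hnorm T α fun s t => Y' t - Y' s

/-- `d_{𝐗,𝐗̃;α}(𝐘,𝐘̃) := ‖R^{𝐘} − R^{𝐘̃}‖_{2α} + ‖Y' − Ỹ'‖_α`. -/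
def crpDist (T α : ℝ) (X Xt : ℝ → V) (Y : ℝ → E) (Y' : ℝ → V →L[ℝ] E)
    (Yt : ℝ → E) (Yt' : ℝ → V →L[ℝ] E) : ℝ :=
  hnorm T (2 * α) (fun s t => Rem X Y Y' s t - Rem Xt Yt Yt' s t) +
    hnorm T α fun s t => (Y' t - Y' s) - (Yt' t - Yt' s)

/-- `p` is a finite partition `s = p 0 < p 1 < ⋯ < p n = t` of `[s,t]`. -/
def IsPartition (s t : ℝ) (n : ℕ) (p : ℕ → ℝ) : Prop :=
  p 0 = s ∧ p n = t ∧ ∀ i < n, p i < p (i + 1)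

end Defs

section Sums

variable {V V2 W U : Type*}
  [NormedAddCommGroup V] [NormedSpace ℝ V] [NormedAddCommGroup V2] [NormedSpace ℝ V2]
  [NormedAddCommGroup W] [NormedSpace ℝ W] [NormedAddCommGroup U] [NormedSpace ℝ U]

/-- The compensated Riemann sum
`∫_P Y dZ := Σ_i [ Y_{t_i}(Z_{t_i,t_{i+1}}) + (Y'_{t_i} ⋆ Z'_{t_i})(𝕏_{t_i,t_{i+1}}) ]`. -/
def rsum (tops : TensorOps V V2 W U) (XX : ℝ → ℝ → V2)
    (Y : ℝ → W →L[ℝ] U) (Y' : ℝ → V →L[ℝ] (W →L[ℝ] U))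
    (Z : ℝ → W) (Z' : ℝ → V →L[ℝ] W) (n : ℕ) (p : ℕ → ℝ) : U :=
  ∑ i ∈ Finset.range n,
    ((Y (p i)) (Z (p (i + 1)) - Z (p i)) +
      (tops.spair (Y' (p i)) (Z' (p i))) (XX (p i) (p (i + 1))))

/-- `I` is the rough integral `∫_s^t Y dZ`: the limit of the compensated Riemann sums
as the mesh of the partition tends to `0`. -/
def IsRoughIntegral (tops : TensorOps V V2 W U) (XX : ℝ → ℝ → V2)
    (Y : ℝ → W →L[ℝ] U) (Y' : ℝ → V →L[ℝ] (W →L[ℝ] U))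
    (Z : ℝ → W) (Z' : ℝ → V →L[ℝ] W) (s t : ℝ) (I : U) : Prop :=
  ∀ ε : ℝ, 0 < ε → ∃ δ : ℝ, 0 < δ ∧ ∀ (n : ℕ) (p : ℕ → ℝ), IsPartition s t n p →
    (∀ i < n, p (i + 1) - p i < δ) → ‖rsum tops XX Y Y' Z Z' n p - I‖ ≤ ε

end Sums

/-- The constant `C_α := (1 + T^α + T^{2α}) · 2^{3α} · Σ_{n≥1} n^{-3α}`. -/
def Calpha (T α : ℝ) : ℝ :=
  (1 + T ^ α + T ^ (2 * α)) * (2 : ℝ) ^ (3 * α) * ∑' n : ℕ, ((n : ℝ) + 1) ^ (-(3 * α))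

/-- `F ∈ C_b^k`: `k` times continuously Fréchet differentiable with all derivatives
up to order `k` bounded. -/
def IsCb {E₁ E₂ : Type*} [NormedAddCommGroup E₁] [NormedSpace ℝ E₁]
    [NormedAddCommGroup E₂] [NormedSpace ℝ E₂] (k : ℕ) (F : E₁ → E₂) : Prop :=
  ContDiff ℝ (k : ℕ∞) F ∧ ∀ j ≤ k, ∃ C : ℝ, ∀ x, ‖iteratedFDeriv ℝ j F x‖ ≤ C

/-- `‖F‖_{C_b^k} := Σ_{j=0}^k sup_x ‖D^j F(x)‖`. -/
def cbNorm {E₁ E₂ : Type*} [NormedAddCommGroup E₁] [NormedSpace ℝ E₁]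
    [NormedAddCommGroup E₂] [NormedSpace ℝ E₂] (k : ℕ) (F : E₁ → E₂) : ℝ :=
  ∑ j ∈ Finset.range (k + 1), ⨆ x : E₁, ‖iteratedFDeriv ℝ j F x‖

end

/-- Removing an interior point from a partition changes a Riemann-type sum only through the
two intervals adjacent to that point. -/
theorem sum_sub_sum_remove_point {ι G : Type*} [AddCommGroup G] (F : ι → ι → G) (p : ℕ → ι)
    (k m : ℕ) :
    (∑ i ∈ Finset.range (k + 2 + m), F (p i) (p (i + 1))) -
        ∑ i ∈ Finset.range (k + 1 + m), F (if i < k + 1 then p i else p (i + 1))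
          (if i + 1 < k + 1 then p (i + 1) else p (i + 1 + 1)) =
      F (p k) (p (k + 1)) + F (p (k + 1)) (p (k + 2)) - F (p k) (p (k + 2)) := by
  induction m with
  | zero =>
    have h : ∑ i ∈ Finset.range k, F (if i < k + 1 then p i else p (i + 1))
        (if i + 1 < k + 1 then p (i + 1) else p (i + 1 + 1)) =
        ∑ i ∈ Finset.range k, F (p i) (p (i + 1)) := by
      refine Finset.sum_congr rfl fun i hi => ?_
      have hik := Finset.mem_range.mp hi
      rw [if_pos (by omega), if_pos (by omega)]
    simp only [add_zero, Finset.sum_range_succ, h, lt_irrefl, if_false, lt_add_one, if_true]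
    abel
  | succ m ih =>
    rw [← ih, ← add_assoc, ← add_assoc, Finset.sum_range_succ, Finset.sum_range_succ _ (k + 1 + m),
      if_neg (by omega : ¬ k + 1 + m < k + 1), if_neg (by omega : ¬ k + 1 + m + 1 < k + 1),
      show k + 1 + m + 1 = k + 2 + m by omega]
    abel

/-- point-removal identity for compensated Riemann sums. -/
theorem stmt0
    {V V2 W U : Type*} [NormedAddCommGroup V] [NormedSpace ℝ V] [CompleteSpace V]
    [NormedAddCommGroup V2] [NormedSpace ℝ V2] [CompleteSpace V2]
    [NormedAddCommGroup W] [NormedSpace ℝ W] [CompleteSpace W]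
    [NormedAddCommGroup U] [NormedSpace ℝ U] [CompleteSpace U]
    (T α : ℝ) (hT : 0 < T) (hα : 1 / 3 < α) (hα' : α ≤ 1 / 2)
    (tops : TensorOps V V2 W U) (X : ℝ → V) (XX : ℝ → ℝ → V2)
    (hX : IsRoughPath T α tops.tmul X XX)
    (Y : ℝ → W →L[ℝ] U) (Y' : ℝ → V →L[ℝ] (W →L[ℝ] U)) (hY : IsCRP T α X Y Y')
    (Z : ℝ → W) (Z' : ℝ → V →L[ℝ] W) (hZ : IsCRP T α X Z Z')
    (n : ℕ) (p : ℕ → ℝ) (hn : 2 ≤ n)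
    (hp0 : 0 ≤ p 0) (hpT : p n ≤ T) (hmono : ∀ i < n, p i < p (i + 1))
    (j : ℕ) (hj1 : 1 ≤ j) (hj2 : j ≤ n - 1) :
    rsum tops XX Y Y' Z Z' n p -
        rsum tops XX Y Y' Z Z' (n - 1) (fun i => if i < j then p i else p (i + 1)) =
      (Rem X Y Y' (p (j - 1)) (p j)) (Rem X Z Z' (p j) (p (j + 1))) +
        (Rem X Y Y' (p (j - 1)) (p j)) ((Z' (p j)) (X (p (j + 1)) - X (p j))) +
        ((Y' (p (j - 1))) (X (p j) - X (p (j - 1)))) (Rem X Z Z' (p j) (p (j + 1))) +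
        (tops.spair (Y' (p (j - 1))) (Z' (p j) - Z' (p (j - 1))))
          (tops.tmul (X (p j) - X (p (j - 1))) (X (p (j + 1)) - X (p j))) +
        (tops.spair (Y' (p j)) (Z' (p j)) - tops.spair (Y' (p (j - 1))) (Z' (p (j - 1))))
          (XX (p j) (p (j + 1))) := by
  obtain ⟨k, rfl⟩ : ∃ k, j = k + 1 := ⟨j - 1, by omega⟩
  obtain ⟨m, rfl⟩ : ∃ m, n = k + 2 + m := ⟨n - (k + 2), by omega⟩
  have hle : ∀ a b : ℕ, a ≤ b → b ≤ k + 2 + m → p a ≤ p b := by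
    intro a b hab
    induction b, hab using Nat.le_induction with
    | base => exact fun _ => le_rfl
    | succ b _ ih => exact fun hb => (ih (by omega)).trans (hmono b (by omega)).le
  have hchen := hX.chen (p k) (p (k + 1)) (p (k + 2)) (hp0.trans (hle 0 k (by omega) (by omega)))
    (hle _ _ (by omega) (by omega)) (hle _ _ (by omega) (by omega))
    ((hle (k + 2) (k + 2 + m) (by omega) le_rfl).trans hpT)
  have hsum := sum_sub_sum_remove_point
    (fun a b => Y a (Z b - Z a) + tops.spair (Y' a) (Z' a) (XX a b)) p k m
  unfold rsum
  rw [show k + 2 + m - 1 = k + 1 + m by omega]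
  refine hsum.trans ?_
  simp only [hchen, Rem, add_tsub_cancel_right, map_add, map_sub, sub_apply,
    tops.spair_tmul]
  abel
end

section
/- Let 𝐗 = (X,𝕏) be a level-2 α-Hölder rough path over V, let 𝐘 = (Y,Y') be an 𝐗-controlled rough path with values in L(W,U) and let 𝐙 = (Z,Z') be an 𝐗-controlled rough path with values in W. Let P : s = t₀ < t₁ < ⋯ < t_n = t be a finite partition of [s,t] ⊆ [0,T] with n ≥ 2 and let 1 ≤ j ≤ n−1. Then ‖∫_P Y dZ − ∫_{P∖{t_j}} Y dZ‖ ≤ (1 + T^α + T^{2α}) (‖Y'_0‖ + ‖𝐘‖_{𝐗;α}) (‖Z'_0‖ + ‖𝐙‖_{𝐗;α}) (1 + ‖𝐗‖_α)² (t_{j+1} − t_{j−1})^{3α}. -/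
/-!  Common definitions: level-2 rough paths, controlled rough paths,
compensated Riemann sums and rough integrals of a controlled rough path
against another controlled rough path. -/

open scoped BigOperators

/-- A Hölder-bounded two-parameter map satisfies the bound with its own seminorm. -/
theorem norm_le_hnorm {E : Type*} [NormedAddCommGroup E] {T β : ℝ} {A : ℝ → ℝ → E}
    (hA : HBound T β A) {s t : ℝ} (hs : 0 ≤ s) (hst : s < t) (ht : t ≤ T) :
    ‖A s t‖ ≤ hnorm T β A * (t - s) ^ β := by
  have hpos : 0 < (t - s) ^ β := Real.rpow_pos_of_pos (sub_pos.2 hst) β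
  rw [← div_le_iff₀ hpos]
  obtain ⟨C, hC⟩ := hA
  refine le_csInf ⟨max C 0, le_max_right _ _, fun a b ha hab hb => (hC a b ha hab hb).trans ?_⟩ ?_
  · exact mul_le_mul_of_nonneg_right (le_max_left _ _)
      (Real.rpow_nonneg (sub_nonneg.2 hab.le) β)
  · rintro D ⟨-, hD⟩
    exact (div_le_iff₀ hpos).2 (hD s t hs hst ht)

theorem hnorm_nonneg {E : Type*} [NormedAddCommGroup E] (T β : ℝ) (A : ℝ → ℝ → E) :
    0 ≤ hnorm T β A :=
  Real.sInf_nonneg fun _ hC => hC.1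

/-- Removing the point with index `i + 1` from a sequence changes a Riemann-type sum only through
the terms at the two adjacent intervals. -/
theorem sum_range_sub_sum_range_remove {P G : Type*} [AddCommGroup G] (g : P → P → G) (p : ℕ → P)
    (i m : ℕ) :
    ∑ k ∈ Finset.range (i + 2 + m), g (p k) (p (k + 1)) -
        ∑ k ∈ Finset.range (i + 1 + m),
          g (if k < i + 1 then p k else p (k + 1))
            (if k + 1 < i + 1 then p (k + 1) else p (k + 1 + 1)) =
      g (p i) (p (i + 1)) + g (p (i + 1)) (p (i + 2)) - g (p i) (p (i + 2)) := by
  rw [Finset.sum_range_add, Finset.sum_range_add _ (i + 1), Finset.sum_range_succ _ (i + 1),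
    Finset.sum_range_succ _ i, Finset.sum_range_succ _ i]
  have hinit : ∑ k ∈ Finset.range i, g (if k < i + 1 then p k else p (k + 1))
      (if k + 1 < i + 1 then p (k + 1) else p (k + 1 + 1)) =
      ∑ k ∈ Finset.range i, g (p k) (p (k + 1)) := by
    refine Finset.sum_congr rfl fun k hk => ?_
    have hk' := Finset.mem_range.1 hk
    rw [if_pos (by omega), if_pos (by omega)]
  have htail : ∑ k ∈ Finset.range m,
      g (if i + 1 + k < i + 1 then p (i + 1 + k) else p (i + 1 + k + 1))
        (if i + 1 + k + 1 < i + 1 then p (i + 1 + k + 1) else p (i + 1 + k + 1 + 1)) =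
      ∑ k ∈ Finset.range m, g (p (i + 2 + k)) (p (i + 2 + k + 1)) := by
    refine Finset.sum_congr rfl fun k _ => ?_
    rw [if_neg (by omega), if_neg (by omega), show i + 1 + k + 1 = i + 2 + k by omega]
  rw [hinit, htail, if_pos (Nat.lt_succ_self i), if_neg (lt_irrefl (i + 1))]
  abel

section PointRemoval

variable {V V2 W U : Type*}
  [NormedAddCommGroup V] [NormedSpace ℝ V] [NormedAddCommGroup V2] [NormedSpace ℝ V2]
  [NormedAddCommGroup W] [NormedSpace ℝ W] [NormedAddCommGroup U] [NormedSpace ℝ U]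

/-- The Gubinelli derivative is bounded on `[0,T]` by its initial value and its seminorm. -/
theorem IsCRP.norm_deriv_le {T α : ℝ} (hT : 0 < T) (hα : 0 ≤ α) {X : ℝ → V} {Y : ℝ → W}
    {Y' : ℝ → V →L[ℝ] W} (hY : IsCRP T α X Y Y') {s : ℝ} (hs : 0 ≤ s) (hsT : s ≤ T) :
    ‖Y' s‖ ≤ ‖Y' 0‖ + hnorm T α (fun s t => Y' t - Y' s) * T ^ α := by
  have hn := hnorm_nonneg T α fun s t => Y' t - Y' s
  rcases hs.eq_or_lt with rfl | hs'
  · exact le_add_of_nonneg_right (mul_nonneg hn (Real.rpow_nonneg hT.le α))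
  · have h := norm_le_hnorm hY.deriv_hold le_rfl hs' hsT
    have hpow : (s - 0) ^ α ≤ T ^ α :=
      Real.rpow_le_rpow (by linarith) (by linarith) hα
    calc ‖Y' s‖ = ‖Y' 0 + (Y' s - Y' 0)‖ := by rw [add_sub_cancel]
      _ ≤ ‖Y' 0‖ + ‖Y' s - Y' 0‖ := norm_add_le _ _
      _ ≤ _ := by gcongr; exact h.trans (mul_le_mul_of_nonneg_left hpow hn)

/-- The defect of additivity of the local expansion, written in terms of increments of the
Gubinelli derivatives and remainders. -/
theorem local_defect_eq (tops : TensorOps V V2 W U) {T α : ℝ} {X : ℝ → V} {XX : ℝ → ℝ → V2}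
    (hX : IsRoughPath T α tops.tmul X XX)
    (Y : ℝ → W →L[ℝ] U) (Y' : ℝ → V →L[ℝ] (W →L[ℝ] U)) (Z : ℝ → W) (Z' : ℝ → V →L[ℝ] W)
    {s u t : ℝ} (hs : 0 ≤ s) (hsu : s ≤ u) (hut : u ≤ t) (ht : t ≤ T) :
    (Y s (Z u - Z s) + tops.spair (Y' s) (Z' s) (XX s u)) +
        (Y u (Z t - Z u) + tops.spair (Y' u) (Z' u) (XX u t)) -
        (Y s (Z t - Z s) + tops.spair (Y' s) (Z' s) (XX s t)) =
      Rem X Y Y' s u (Z' u (X t - X u) + Rem X Z Z' u t) +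
        Y' s (X u - X s) (Rem X Z Z' u t) +
        Y' s (X u - X s) ((Z' u - Z' s) (X t - X u)) +
        tops.spair (Y' u - Y' s) (Z' u) (XX u t) +
        tops.spair (Y' s) (Z' u - Z' s) (XX u t) := by
  rw [hX.chen s u t hs hsu hut ht]
  simp only [Rem, map_add, map_sub, sub_apply, tops.spair_tmul]
  abel

/-- The numerical inequality between the constants in the point-removal estimate. -/
theorem point_removal_constant_le {y r d z q e x w τ : ℝ} (hy : 0 ≤ y) (hr : 0 ≤ r) (hd : 0 ≤ d)
    (hz : 0 ≤ z) (hq : 0 ≤ q) (he : 0 ≤ e) (hx : 0 ≤ x) (hw : 0 ≤ w) (hτ : 0 ≤ τ) :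
    r * ((z + e * τ) * x + q * τ) + (y + d * τ) * x * q + (y + d * τ) * x * (e * x) +
        d * (z + e * τ) * w + (y + d * τ) * e * w ≤
      (1 + τ + τ ^ 2) * (y + (r + d)) * (z + (q + e)) * (1 + (x + w)) ^ 2 := by
  have h₁ : 1 ≤ (1 + (x + w)) ^ 2 := one_le_pow₀ (by linarith)
  have h₂ : x ≤ (1 + (x + w)) ^ 2 := by nlinarith [mul_nonneg hx hw]
  have h₃ : x ^ 2 + 2 * w ≤ (1 + (x + w)) ^ 2 := by nlinarith [mul_nonneg hx hw]
  have h₄ : x ^ 2 + w ≤ (1 + (x + w)) ^ 2 := by linarith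
  have h₅ : w ≤ (1 + (x + w)) ^ 2 := by nlinarith [mul_nonneg hx hw]
  generalize (1 + (x + w)) ^ 2 = S at *
  calc
    _ = r * z * x + r * e * τ * x + r * q * τ * 1 + y * q * x + d * q * τ * x +
        y * e * (x ^ 2 + w) + d * e * τ * (x ^ 2 + 2 * w) + d * z * w := by ring
    _ ≤ r * z * S + r * e * τ * S + r * q * τ * S + y * q * S + d * q * τ * S +
        y * e * S + d * e * τ * S + d * z * S := by gcongr
    _ = (r * z + r * e * τ + r * q * τ + y * q + d * q * τ + y * e + d * e * τ + d * z) * S := by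
      ring
    _ ≤ _ := by
      refine mul_le_mul_of_nonneg_right ?_ (zero_le_one.trans h₁)
      rw [← sub_nonneg]
      ring_nf
      positivity

/-- The local expansion is almost additive, with exponent `3α`. -/
theorem norm_local_defect_le {T α : ℝ} (hT : 0 < T) (hα : 0 ≤ α)
    (tops : TensorOps V V2 W U) {X : ℝ → V} {XX : ℝ → ℝ → V2}
    (hX : IsRoughPath T α tops.tmul X XX)
    {Y : ℝ → W →L[ℝ] U} {Y' : ℝ → V →L[ℝ] (W →L[ℝ] U)} (hY : IsCRP T α X Y Y')
    {Z : ℝ → W} {Z' : ℝ → V →L[ℝ] W} (hZ : IsCRP T α X Z Z')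
    {s u t : ℝ} (hs : 0 ≤ s) (hsu : s < u) (hut : u < t) (ht : t ≤ T) :
    ‖(Y s (Z u - Z s) + tops.spair (Y' s) (Z' s) (XX s u)) +
        (Y u (Z t - Z u) + tops.spair (Y' u) (Z' u) (XX u t)) -
        (Y s (Z t - Z s) + tops.spair (Y' s) (Z' s) (XX s t))‖ ≤
      (1 + T ^ α + T ^ (2 * α)) * (‖Y' 0‖ + crpNorm T α X Y Y') *
        (‖Z' 0‖ + crpNorm T α X Z Z') * (1 + rpNorm T α X XX) ^ 2 * (t - s) ^ (3 * α) := by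
  rw [local_defect_eq tops hX Y Y' Z Z' hs hsu.le hut.le ht]
  have hpow2 {a : ℝ} (ha : 0 ≤ a) : a ^ (2 * α) = (a ^ α) ^ 2 := by
    rw [mul_comm, Real.rpow_mul ha, Real.rpow_two]
  have hpow3 {a : ℝ} (ha : 0 ≤ a) : a ^ (3 * α) = (a ^ α) ^ 3 := by
    rw [mul_comm, Real.rpow_mul ha]
    exact Real.rpow_natCast _ 3
  have huT : u ≤ T := hut.le.trans ht
  have hu : 0 ≤ u := hs.trans hsu.le
  have hMY := hY.norm_deriv_le hT hα hs (hsu.le.trans huT)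
  have hMZ := hZ.norm_deriv_le hT hα hu huT
  have hRY := norm_le_hnorm hY.rem_hold hs hsu huT
  have hRZ := norm_le_hnorm hZ.rem_hold hu hut ht
  have hDY := norm_le_hnorm hY.deriv_hold hs hsu huT
  have hDZ := norm_le_hnorm hZ.deriv_hold hs hsu huT
  have hX₁ := norm_le_hnorm hX.x_hold hs hsu huT
  have hX₂ := norm_le_hnorm hX.x_hold hu hut ht
  have hXX := norm_le_hnorm hX.xx_hold hu hut ht
  rw [hpow2 (sub_nonneg.2 hsu.le)] at hRY
  rw [hpow2 (sub_nonneg.2 hut.le)] at hRZ hXX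
  rw [hpow2 hT.le, hpow3 (by linarith : 0 ≤ t - s)]
  unfold crpNorm rpNorm
  have hr := hnorm_nonneg T (2 * α) (Rem X Y Y')
  have hq := hnorm_nonneg T (2 * α) (Rem X Z Z')
  have hd := hnorm_nonneg T α fun s t => Y' t - Y' s
  have he := hnorm_nonneg T α fun s t => Z' t - Z' s
  have hx := hnorm_nonneg T α fun s t => X t - X s
  have hw := hnorm_nonneg T (2 * α) XX
  have hy := norm_nonneg (Y' 0)
  have hz := norm_nonneg (Z' 0)
  generalize hnorm T (2 * α) (Rem X Y Y') = r at *
  generalize hnorm T (2 * α) (Rem X Z Z') = q at *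
  generalize hnorm T α (fun s t => Y' t - Y' s) = d at *
  generalize hnorm T α (fun s t => Z' t - Z' s) = e at *
  generalize hnorm T α (fun s t => X t - X s) = x at *
  generalize hnorm T (2 * α) XX = w at *
  generalize ‖Y' 0‖ = y at *
  generalize ‖Z' 0‖ = z at *
  have hA : (u - s) ^ α ≤ (t - s) ^ α := Real.rpow_le_rpow (by linarith) (by linarith) hα
  have hB : (t - u) ^ α ≤ (t - s) ^ α := Real.rpow_le_rpow (by linarith) (by linarith) hα
  have hHτ : (t - s) ^ α ≤ T ^ α := Real.rpow_le_rpow (by linarith) (by linarith) hα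
  have hA0 : 0 ≤ (u - s) ^ α := Real.rpow_nonneg (by linarith) α
  have hB0 : 0 ≤ (t - u) ^ α := Real.rpow_nonneg (by linarith) α
  generalize (u - s) ^ α = A at *
  generalize (t - u) ^ α = B at *
  generalize (t - s) ^ α = H at *
  generalize T ^ α = τ at *
  have hH : 0 ≤ H := hA0.trans hA
  have hτ : 0 ≤ τ := hH.trans hHτ
  replace hRY : ‖Rem X Y Y' s u‖ ≤ r * H ^ 2 := hRY.trans (by gcongr)
  replace hRZ : ‖Rem X Z Z' u t‖ ≤ q * H ^ 2 := hRZ.trans (by gcongr)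
  replace hDY : ‖Y' u - Y' s‖ ≤ d * H := hDY.trans (by gcongr)
  replace hDZ : ‖Z' u - Z' s‖ ≤ e * H := hDZ.trans (by gcongr)
  replace hX₁ : ‖X u - X s‖ ≤ x * H := hX₁.trans (by gcongr)
  replace hX₂ : ‖X t - X u‖ ≤ x * H := hX₂.trans (by gcongr)
  replace hXX : ‖XX u t‖ ≤ w * H ^ 2 := hXX.trans (by gcongr)
  have hYX : ‖Y' s (X u - X s)‖ ≤ (y + d * τ) * (x * H) := (Y' s).le_of_opNorm_le_of_le hMY hX₁
  have hZX : ‖Z' u (X t - X u)‖ ≤ (z + e * τ) * (x * H) := (Z' u).le_of_opNorm_le_of_le hMZ hX₂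
  have hDX : ‖(Z' u - Z' s) (X t - X u)‖ ≤ e * H * (x * H) :=
    (Z' u - Z' s).le_of_opNorm_le_of_le hDZ hX₂
  have hZ₂ : ‖Z' u (X t - X u) + Rem X Z Z' u t‖ ≤ (z + e * τ) * (x * H) + q * (H * τ) :=
    (norm_add_le _ _).trans (add_le_add hZX (hRZ.trans (by rw [sq]; gcongr)))
  have hP₁ : ‖tops.spair (Y' u - Y' s) (Z' u)‖ ≤ d * H * (z + e * τ) :=
    (tops.spair_le _ _).trans (by gcongr)
  have hP₂ : ‖tops.spair (Y' s) (Z' u - Z' s)‖ ≤ (y + d * τ) * (e * H) :=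
    (tops.spair_le _ _).trans (by gcongr)
  have h₁ := ContinuousLinearMap.le_of_opNorm_le_of_le _ hRY hZ₂
  have h₂ := ContinuousLinearMap.le_of_opNorm_le_of_le _ hYX hRZ
  have h₃ := ContinuousLinearMap.le_of_opNorm_le_of_le _ hYX hDX
  have h₄ := ContinuousLinearMap.le_of_opNorm_le_of_le _ hP₁ hXX
  have h₅ := ContinuousLinearMap.le_of_opNorm_le_of_le _ hP₂ hXX
  refine (norm_add_le_of_le (norm_add_le_of_le (norm_add_le_of_le
    (norm_add_le_of_le h₁ h₂) h₃) h₄) h₅).trans ?_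
  refine le_of_eq_of_le ?_ (mul_le_mul_of_nonneg_right
    (point_removal_constant_le hy hr hd hz hq he hx hw hτ) (pow_nonneg hH 3))
  ring

end PointRemoval

/-- point-removal estimate. -/
theorem stmt1
    {V V2 W U : Type*} [NormedAddCommGroup V] [NormedSpace ℝ V] [CompleteSpace V]
    [NormedAddCommGroup V2] [NormedSpace ℝ V2] [CompleteSpace V2]
    [NormedAddCommGroup W] [NormedSpace ℝ W] [CompleteSpace W]
    [NormedAddCommGroup U] [NormedSpace ℝ U] [CompleteSpace U]
    (T α : ℝ) (hT : 0 < T) (hα : 1 / 3 < α) (hα' : α ≤ 1 / 2)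
    (tops : TensorOps V V2 W U) (X : ℝ → V) (XX : ℝ → ℝ → V2)
    (hX : IsRoughPath T α tops.tmul X XX)
    (Y : ℝ → W →L[ℝ] U) (Y' : ℝ → V →L[ℝ] (W →L[ℝ] U)) (hY : IsCRP T α X Y Y')
    (Z : ℝ → W) (Z' : ℝ → V →L[ℝ] W) (hZ : IsCRP T α X Z Z')
    (n : ℕ) (p : ℕ → ℝ) (hn : 2 ≤ n)
    (hp0 : 0 ≤ p 0) (hpT : p n ≤ T) (hmono : ∀ i < n, p i < p (i + 1))
    (j : ℕ) (hj1 : 1 ≤ j) (hj2 : j ≤ n - 1) :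
    ‖rsum tops XX Y Y' Z Z' n p -
        rsum tops XX Y Y' Z Z' (n - 1) (fun i => if i < j then p i else p (i + 1))‖ ≤
      (1 + T ^ α + T ^ (2 * α)) * (‖Y' 0‖ + crpNorm T α X Y Y') *
        (‖Z' 0‖ + crpNorm T α X Z Z') * (1 + rpNorm T α X XX) ^ 2 *
        (p (j + 1) - p (j - 1)) ^ (3 * α) := by
  obtain ⟨i, rfl⟩ : ∃ i, j = i + 1 := ⟨j - 1, by omega⟩
  obtain ⟨m, rfl⟩ : ∃ m, n = i + 2 + m := ⟨n - (i + 2), by omega⟩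
  have hle : ∀ a b, a ≤ b → b ≤ i + 2 + m → p a ≤ p b := fun a b hab hb =>
    Nat.le_induction (P := fun b _ => b ≤ i + 2 + m → p a ≤ p b) (fun _ => le_rfl)
      (fun k _ ih hk => (ih (by omega)).trans (hmono k (by omega)).le) b hab hb
  have h := norm_local_defect_le hT (by linarith) tops hX hY hZ
    (hp0.trans (hle 0 i (by omega) (by omega))) (hmono i (by omega)) (hmono (i + 1) (by omega))
    ((hle (i + 2) (i + 2 + m) (by omega) le_rfl).trans hpT)
  rw [← sum_range_sub_sum_range_remove
    (fun a b => Y a (Z b - Z a) + tops.spair (Y' a) (Z' a) (XX a b)) p i m] at h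
  rw [show i + 2 + m - 1 = i + 1 + m by omega]
  exact h
end

section
/- Let 𝐗 = (X,𝕏) be a level-2 α-Hölder rough path over V, let 𝐘 = (Y,Y') be an 𝐗-controlled rough path with values in L(W,U) and let 𝐙 = (Z,Z') be an 𝐗-controlled rough path with values in W. Then for every 0 ≤ s ≤ t ≤ T there exists I ∈ U such that for every ε > 0 there exists δ > 0 such that ‖∫_P Y dZ − I‖ ≤ ε for every finite partition P of [s,t] with mesh |P| < δ; in other words, the compensated Riemann sums converge as the mesh tends to 0, so the rough integral ∫_s^t Y dZ := I is well-defined. -/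
/-!  Common definitions: level-2 rough paths, controlled rough paths,
compensated Riemann sums and rough integrals of a controlled rough path
against another controlled rough path. -/

open scoped BigOperators

open Finset in
/-- Maximal inequality of the sewing lemma, for weakly monotone partitions. -/
theorem norm_sum_Ico_sub_le {E : Type*} [NormedAddCommGroup E] {a b C θ : ℝ}
    {Ξ : ℝ → ℝ → E} (hC : 0 ≤ C) (hθ : 1 < θ) (hdiag : ∀ x, a ≤ x → x ≤ b → Ξ x x = 0)
    (hdefect : ∀ x y z, a ≤ x → x ≤ y → y ≤ z → z ≤ b →
      ‖Ξ x z - Ξ x y - Ξ y z‖ ≤ C * (z - x) ^ θ)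
    {p : ℕ → ℝ} (hp : Monotone p) (hpa : ∀ i, a ≤ p i) (hpb : ∀ i, p i ≤ b)
    (n m : ℕ) :
    ‖∑ i ∈ Ico m (m + n), Ξ (p i) (p (i + 1)) - Ξ (p m) (p (m + n))‖ ≤
      2 * C / (1 - 2 * (1 / 2) ^ θ) * (p (m + n) - p m) ^ θ := by
  have hhalf : ((1 : ℝ) / 2) ^ θ < 1 / 2 := by
    simpa using Real.rpow_lt_rpow_of_exponent_gt (x := 1 / 2) (by norm_num) (by norm_num) hθ
  set K := 2 * C / (1 - 2 * ((1 : ℝ) / 2) ^ θ) with hK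
  have hden : 0 < 1 - 2 * ((1 : ℝ) / 2) ^ θ := by linarith
  have hK0 : 0 ≤ K := by positivity
  have hKeq : K - 2 * (1 / 2) ^ θ * K = 2 * C := by
    rw [hK]; field_simp
  induction n using Nat.strong_induction_on generalizing m with
  | _ n ih =>
    rcases Nat.eq_zero_or_pos n with rfl | hn
    · simp [hdiag _ (hpa m) (hpb m), Real.zero_rpow (by linarith : θ ≠ 0)]
    have hL : 0 ≤ p (m + n) - p m := sub_nonneg.2 (hp (by omega))
    set L := p (m + n) - p m with hLdef
    obtain ⟨k, hkn, hk1, hk2⟩ : ∃ k < n, p (m + k) ≤ p m + L / 2 ∧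
        p m + L / 2 ≤ p (m + k + 1) := by
      have hex : ∃ j, p m + L / 2 ≤ p (m + j + 1) :=
        ⟨n, le_trans (by rw [hLdef]; linarith) (hp (Nat.le_succ _))⟩
      classical
      have hex' : p m + L / 2 ≤ p (m + (n - 1) + 1) := by
        rw [show m + (n - 1) + 1 = m + n by omega]; linarith
      refine ⟨Nat.find hex, ?_, ?_, Nat.find_spec hex⟩
      · have := Nat.find_min' hex hex'
        omega
      · rcases Nat.eq_zero_or_pos (Nat.find hex) with h0 | h0
        · rw [h0]; simp; linarith
        · have := Nat.find_min hex (m := Nat.find hex - 1) (by omega)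
          rw [show m + (Nat.find hex - 1) + 1 = m + Nat.find hex by omega] at this
          exact (not_le.1 this).le
    have h1 := ih k hkn m
    have h2 := ih (n - (k + 1)) (by omega) (m + k + 1)
    rw [show m + k + 1 + (n - (k + 1)) = m + n by omega] at h2
    have hm1 : p m ≤ p (m + k) := hp (by omega)
    have hm2 : p (m + k) ≤ p (m + k + 1) := hp (by omega)
    have hm3 : p (m + k + 1) ≤ p (m + n) := hp (by omega)
    have d1 := hdefect _ _ _ (hpa m) hm1 (hm2.trans hm3) (hpb _)
    have d2 := hdefect _ _ _ (hpa (m + k)) hm2 hm3 (hpb _)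
    have e2 : (p (m + n) - p (m + k)) ^ θ ≤ L ^ θ :=
      Real.rpow_le_rpow (by linarith) (by linarith) (by linarith)
    have hLhalf : (L / 2) ^ θ = (1 / 2) ^ θ * L ^ θ := by
      rw [← Real.mul_rpow (by norm_num) hL]; ring_nf
    have e3 : (p (m + k) - p m) ^ θ ≤ (1 / 2) ^ θ * L ^ θ := by
      rw [← hLhalf]; exact Real.rpow_le_rpow (by linarith) (by linarith) (by linarith)
    have e4 : (p (m + n) - p (m + k + 1)) ^ θ ≤ (1 / 2) ^ θ * L ^ θ := by
      rw [← hLhalf]; exact Real.rpow_le_rpow (by linarith) (by linarith) (by linarith)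
    have hsum : ∑ i ∈ Ico m (m + n), Ξ (p i) (p (i + 1)) =
        ∑ i ∈ Ico m (m + k), Ξ (p i) (p (i + 1)) + Ξ (p (m + k)) (p (m + k + 1)) +
          ∑ i ∈ Ico (m + k + 1) (m + n), Ξ (p i) (p (i + 1)) := by
      rw [← Finset.sum_Ico_succ_top (by omega), Finset.sum_Ico_consecutive _ (by omega) (by omega)]
    rw [hsum]
    calc _ = ‖(∑ i ∈ Ico m (m + k), Ξ (p i) (p (i + 1)) - Ξ (p m) (p (m + k))) +
          (∑ i ∈ Ico (m + k + 1) (m + n), Ξ (p i) (p (i + 1)) -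
            Ξ (p (m + k + 1)) (p (m + n))) -
          (Ξ (p m) (p (m + n)) - Ξ (p m) (p (m + k)) - Ξ (p (m + k)) (p (m + n))) -
          (Ξ (p (m + k)) (p (m + n)) - Ξ (p (m + k)) (p (m + k + 1)) -
            Ξ (p (m + k + 1)) (p (m + n)))‖ := by congr 1; abel
      _ ≤ K * (p (m + k) - p m) ^ θ + K * (p (m + n) - p (m + k + 1)) ^ θ + C * L ^ θ +
          C * (p (m + n) - p (m + k)) ^ θ :=
        norm_sub_le_of_le (norm_sub_le_of_le (norm_add_le_of_le h1 h2) d1) d2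
      _ ≤ K * ((1 / 2) ^ θ * L ^ θ) + K * ((1 / 2) ^ θ * L ^ θ) + C * L ^ θ + C * L ^ θ := by
        gcongr
      _ = (2 * (1 / 2) ^ θ * K + 2 * C) * L ^ θ := by ring
      _ = K * L ^ θ := by rw [← hKeq]; ring

/-- Clamping one interval into another is symmetric up to degenerate intervals. -/
theorem clamp_interval_comm {E : Type*} [AddCommGroup E] {a b : ℝ} {Ξ : ℝ → ℝ → E}
    (hdiag : ∀ x, a ≤ x → x ≤ b → Ξ x x = 0) {x x' y y' : ℝ} (hx : x ≤ x') (hy : y ≤ y')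
    (hax : a ≤ x) (hxb : x' ≤ b) (hay : a ≤ y) (hyb : y' ≤ b) :
    Ξ (max x (min y x')) (max x (min y' x')) = Ξ (max y (min x y')) (max y (min x' y')) := by
  rcases lt_or_ge (max x y) (min x' y') with h | h
  · obtain ⟨⟨h1, h2⟩, h3, h4⟩ := (by simpa using h : (x < x' ∧ y < x') ∧ x < y' ∧ y < y')
    rw [min_eq_left h2.le, min_eq_left h3.le, max_comm y x, min_comm y' x',
      max_eq_right (le_min h1.le h3.le), max_eq_right (le_min h2.le h4.le)]
  · have key : ∀ u u' v v' : ℝ, u ≤ u' → v ≤ v' → a ≤ u → u' ≤ b → min u' v' ≤ max u v →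
        Ξ (max u (min v u')) (max u (min v' u')) = 0 := by
      intro u u' v v' hu hv hau hub h
      have : max u (min v u') = max u (min v' u') := by
        apply le_antisymm (max_le_max_left _ (min_le_min_right _ hv))
        refine max_le (le_max_left _ _) ?_
        rw [max_min_distrib_left]
        refine le_min ?_ ((min_le_right _ _).trans (le_max_right _ _))
        rwa [min_comm]
      rw [this]
      exact hdiag _ (hau.trans (le_max_left _ _))
        (max_le (hu.trans hub) ((min_le_right _ _).trans hub))
    rw [key x x' y y' hx hy hax hxb h, key y y' x x' hy hx hay hyb (by rwa [min_comm, max_comm])]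

/-- Power sums of the increments are controlled by the mesh. -/
theorem sum_rpow_le_mesh {θ δ : ℝ} (hθ : 1 < θ) {p : ℕ → ℝ} (hp : Monotone p) (n : ℕ)
    (hmesh : ∀ i < n, p (i + 1) - p i ≤ δ) :
    ∑ i ∈ Finset.range n, (p (i + 1) - p i) ^ θ ≤ δ ^ (θ - 1) * (p n - p 0) := by
  rw [← Finset.sum_range_sub, Finset.mul_sum]
  refine Finset.sum_le_sum fun i hi => ?_
  have h0 : 0 ≤ p (i + 1) - p i := sub_nonneg.2 (hp (Nat.le_succ i))
  have : (p (i + 1) - p i) ^ θ = (p (i + 1) - p i) ^ (θ - 1) * (p (i + 1) - p i) := by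
    rw [← Real.rpow_add_one' h0 (by linarith)]; simp
  rw [this]
  exact mul_le_mul_of_nonneg_right
    (Real.rpow_le_rpow h0 (hmesh i (Finset.mem_range.1 hi)) (by linarith)) h0

open Finset in
/-- A Riemann sum is close to the Riemann sum over a common refinement. -/
theorem norm_sum_sub_refinement_le {E : Type*} [NormedAddCommGroup E] {a b C θ δ : ℝ}
    {Ξ : ℝ → ℝ → E} (hC : 0 ≤ C) (hθ : 1 < θ) (hdiag : ∀ x, a ≤ x → x ≤ b → Ξ x x = 0)
    (hdefect : ∀ x y z, a ≤ x → x ≤ y → y ≤ z → z ≤ b →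
      ‖Ξ x z - Ξ x y - Ξ y z‖ ≤ C * (z - x) ^ θ)
    {p q : ℕ → ℝ} (hp : Monotone p) (hpa : ∀ i, a ≤ p i) (hpb : ∀ i, p i ≤ b)
    (hq : Monotone q) {n m : ℕ} (hp0 : p 0 = a) (hpn : p n = b) (hq0 : q 0 = a) (hqm : q m = b)
    (hmesh : ∀ i < n, p (i + 1) - p i ≤ δ) :
    ‖∑ i ∈ range n, Ξ (p i) (p (i + 1)) - ∑ i ∈ range n, ∑ j ∈ range m,
      Ξ (max (p i) (min (q j) (p (i + 1)))) (max (p i) (min (q (j + 1)) (p (i + 1))))‖ ≤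
      2 * C / (1 - 2 * (1 / 2) ^ θ) * (δ ^ (θ - 1) * (b - a)) := by
  have hhalf : ((1 : ℝ) / 2) ^ θ < 1 / 2 := by
    simpa using Real.rpow_lt_rpow_of_exponent_gt (x := 1 / 2) (by norm_num) (by norm_num) hθ
  have hden : 0 < 1 - 2 * ((1 : ℝ) / 2) ^ θ := by linarith
  rw [← Finset.sum_sub_distrib]
  have hS := sum_rpow_le_mesh hθ hp n hmesh
  rw [hp0, hpn] at hS
  refine le_trans ?_ (mul_le_mul_of_nonneg_left hS (by positivity))
  rw [Finset.mul_sum]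
  refine norm_sum_le_of_le _ fun i _ => ?_
  have hi := hp (Nat.le_succ i)
  have h := norm_sum_Ico_sub_le hC hθ hdiag hdefect
    (p := fun j => max (p i) (min (q j) (p (i + 1))))
    (fun j k hjk => max_le_max_left _ (min_le_min_right _ (hq hjk)))
    (fun j => (hpa i).trans (le_max_left _ _))
    (fun j => max_le (hpb i) ((min_le_right _ _).trans (hpb _))) m 0
  simp only [zero_add, hq0, hqm, min_eq_left (hpa _), max_eq_left (hpa _),
    min_eq_right (hpb _), max_eq_right hi, Nat.Ico_zero_eq_range] at h
  rwa [norm_sub_rev] at h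

open Finset in
/-- Two Riemann sums of fine mesh are close to each other. -/
theorem norm_sum_sub_sum_le_mesh {E : Type*} [NormedAddCommGroup E] {a b C θ δ δ' : ℝ}
    {Ξ : ℝ → ℝ → E} (hC : 0 ≤ C) (hθ : 1 < θ) (hdiag : ∀ x, a ≤ x → x ≤ b → Ξ x x = 0)
    (hdefect : ∀ x y z, a ≤ x → x ≤ y → y ≤ z → z ≤ b →
      ‖Ξ x z - Ξ x y - Ξ y z‖ ≤ C * (z - x) ^ θ)
    {p q : ℕ → ℝ} (hp : Monotone p) (hpa : ∀ i, a ≤ p i) (hpb : ∀ i, p i ≤ b)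
    (hq : Monotone q) (hqa : ∀ i, a ≤ q i) (hqb : ∀ i, q i ≤ b)
    {n m : ℕ} (hp0 : p 0 = a) (hpn : p n = b) (hq0 : q 0 = a) (hqm : q m = b)
    (hpmesh : ∀ i < n, p (i + 1) - p i ≤ δ) (hqmesh : ∀ i < m, q (i + 1) - q i ≤ δ') :
    ‖∑ i ∈ range n, Ξ (p i) (p (i + 1)) - ∑ j ∈ range m, Ξ (q j) (q (j + 1))‖ ≤
      2 * C / (1 - 2 * (1 / 2) ^ θ) * (b - a) * (δ ^ (θ - 1) + δ' ^ (θ - 1)) := by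
  have h1 := norm_sum_sub_refinement_le hC hθ hdiag hdefect hp hpa hpb hq hp0 hpn hq0 hqm hpmesh
  have h2 := norm_sum_sub_refinement_le hC hθ hdiag hdefect hq hqa hqb hp hq0 hqm hp0 hpn hqmesh
  rw [Finset.sum_comm] at h2
  simp_rw [fun i j => clamp_interval_comm hdiag (hq (Nat.le_succ j)) (hp (Nat.le_succ i))
    (hqa j) (hqb (j + 1)) (hpa i) (hpb (i + 1))] at h2
  rw [norm_sub_rev] at h2
  have h3 := norm_add_le_of_le h1 h2
  rw [sub_add_sub_cancel] at h3
  exact h3.trans_eq (by ring)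

open Finset Filter Topology in
/-- Sewing lemma: Riemann sums of an almost additive map converge as the mesh tends to `0`. -/
theorem exists_tendsto_sum_of_almost_additive {E : Type*} [NormedAddCommGroup E]
    [CompleteSpace E] {a b C θ : ℝ}
    {Ξ : ℝ → ℝ → E} (hab : a ≤ b) (hC : 0 ≤ C) (hθ : 1 < θ)
    (hdiag : ∀ x, a ≤ x → x ≤ b → Ξ x x = 0)
    (hdefect : ∀ x y z, a ≤ x → x ≤ y → y ≤ z → z ≤ b →
      ‖Ξ x z - Ξ x y - Ξ y z‖ ≤ C * (z - x) ^ θ) :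
    ∃ I : E, ∀ ε : ℝ, 0 < ε → ∃ δ : ℝ, 0 < δ ∧ ∀ (n : ℕ) (p : ℕ → ℝ), IsPartition a b n p →
      (∀ i < n, p (i + 1) - p i < δ) →
        ‖∑ i ∈ range n, Ξ (p i) (p (i + 1)) - I‖ ≤ ε := by
  have hhalf : ((1 : ℝ) / 2) ^ θ < 1 / 2 := by
    simpa using Real.rpow_lt_rpow_of_exponent_gt (x := 1 / 2) (by norm_num) (by norm_num) hθ
  have hden : 0 < 1 - 2 * ((1 : ℝ) / 2) ^ θ := by linarith
  set K := 2 * C / (1 - 2 * ((1 : ℝ) / 2) ^ θ) * (b - a) with hK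
  have hba : 0 ≤ b - a := sub_nonneg.2 hab
  have hK0 : 0 ≤ K := by positivity
  let q : ℕ → ℕ → ℝ := fun N i => min (a + (b - a) / (N + 1) * i) b
  have hq : ∀ N, Monotone (q N) := fun N i j hij => by
    have : (i : ℝ) ≤ j := by exact_mod_cast hij
    exact min_le_min_right _ (by gcongr)
  have hqa : ∀ N i, a ≤ q N i := fun N i => le_min (le_add_of_nonneg_right (by positivity)) hab
  have hqb : ∀ N i, q N i ≤ b := fun N i => min_le_right _ _
  have hq0 : ∀ N, q N 0 = a := fun N => by simp [q, hab]
  have hqN : ∀ N, q N (N + 1) = b := fun N => by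
    have : (b - a) / ((N : ℝ) + 1) * ((N : ℝ) + 1) = b - a := by field_simp
    simp [q, this]
  have hqmesh : ∀ N, ∀ i < N + 1, q N (i + 1) - q N i ≤ (b - a) / (N + 1) := fun N i _ => by
    have h0 : 0 ≤ (b - a) / ((N : ℝ) + 1) := by positivity
    rw [sub_le_iff_le_add]
    simp only [q]
    rw [← min_add_add_left]
    refine le_min ((min_le_left _ _).trans_eq ?_) ((min_le_right _ _).trans (by linarith))
    push_cast; ring
  have hlim : Tendsto (fun N : ℕ => ((b - a) / ((N : ℝ) + 1)) ^ (θ - 1)) atTop (𝓝 0) := by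
    have h1 : Tendsto (fun N : ℕ => (b - a) / ((N : ℝ) + 1)) atTop (𝓝 0) :=
      tendsto_const_nhds.div_atTop (tendsto_atTop_add_const_right _ _ tendsto_natCast_atTop_atTop)
    simpa [Real.zero_rpow (by linarith : θ - 1 ≠ 0)] using
      h1.rpow_const (p := θ - 1) (Or.inr (by linarith))
  let S : ℕ → E := fun N => ∑ i ∈ range (N + 1), Ξ (q N i) (q N (i + 1))
  have hcauchy : CauchySeq S := by
    rw [Metric.cauchySeq_iff']
    intro ε hε
    have hev : ∀ᶠ N : ℕ in atTop, K * ((b - a) / ((N : ℝ) + 1)) ^ (θ - 1) < ε / 2 := by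
      have := hlim.const_mul K
      rw [mul_zero] at this
      exact this.eventually_lt_const (by positivity)
    obtain ⟨N, hN⟩ := eventually_atTop.1 hev
    refine ⟨N, fun n hn => ?_⟩
    rw [dist_eq_norm]
    have := norm_sum_sub_sum_le_mesh hC hθ hdiag hdefect (hq n) (hqa n) (hqb n) (hq N) (hqa N)
      (hqb N) (hq0 n) (hqN n) (hq0 N) (hqN N) (hqmesh n) (hqmesh N)
    have h1 := hN n hn
    have h2 := hN N le_rfl
    rw [← hK, mul_add] at this
    exact this.trans_lt (by linarith)
  obtain ⟨I, hI⟩ := cauchySeq_tendsto_of_complete hcauchy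
  refine ⟨I, fun ε hε => ?_⟩
  have hpow : Tendsto (fun δ : ℝ => K * δ ^ (θ - 1)) (𝓝[>] 0) (𝓝 0) := by
    have h1 : Tendsto (fun δ : ℝ => δ) (𝓝[>] (0 : ℝ)) (𝓝 0) := nhdsWithin_le_nhds
    simpa [Real.zero_rpow (by linarith : θ - 1 ≠ 0)] using
      (h1.rpow_const (p := θ - 1) (Or.inr (by linarith))).const_mul K
  obtain ⟨δ, hδ, hδ0⟩ :=
    ((hpow.eventually_lt_const hε).and self_mem_nhdsWithin).exists
  refine ⟨δ, hδ0, fun n p hp hmesh => ?_⟩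
  obtain ⟨hp0, hpn, hlt⟩ := hp
  have hmono : Monotone fun i => p (min i n) := by
    refine monotone_nat_of_le_succ fun i => ?_
    rcases lt_or_ge i n with h | h
    · simpa [min_eq_left h.le, min_eq_left (Nat.succ_le_of_lt h)] using (hlt i h).le
    · simp [min_eq_right h, min_eq_right (h.trans (Nat.le_succ i))]
  have hsucc : ∀ i < n, p (min i n) = p i ∧ p (min (i + 1) n) = p (i + 1) := fun i h => by
    simp [min_eq_left h.le, min_eq_left (Nat.succ_le_of_lt h)]
  have hsum : ∑ i ∈ range n, Ξ (p (min i n)) (p (min (i + 1) n)) =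
      ∑ i ∈ range n, Ξ (p i) (p (i + 1)) := Finset.sum_congr rfl fun i hi => by
    rw [(hsucc i (mem_range.1 hi)).1, (hsucc i (mem_range.1 hi)).2]
  have hbound : ∀ N, ‖∑ i ∈ range n, Ξ (p i) (p (i + 1)) - S N‖ ≤
      K * (δ ^ (θ - 1) + ((b - a) / ((N : ℝ) + 1)) ^ (θ - 1)) := fun N => by
    rw [← hsum]
    refine norm_sum_sub_sum_le_mesh hC hθ hdiag hdefect hmono (fun i => ?_) (fun i => ?_)
      (hq N) (hqa N) (hqb N) (by simpa using hp0) (by simpa using hpn) (hq0 N) (hqN N)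
      (fun i hi => ?_) (hqmesh N)
    · simpa [hp0] using hmono (Nat.zero_le i)
    · have h := hmono (le_max_left i n)
      simpa [hpn] using h
    · simp only [(hsucc i hi).1, (hsucc i hi).2]
      exact (hmesh i hi).le
  have := le_of_tendsto_of_tendsto' (tendsto_const_nhds.sub hI).norm
    ((hlim.const_add (δ ^ (θ - 1))).const_mul K) hbound
  rw [add_zero] at this
  exact this.trans hδ.le

/-- A Hölder bound extends to the diagonal for maps vanishing there. -/
theorem HBound.exists_nonneg {E : Type*} [NormedAddCommGroup E] {T β : ℝ} {A : ℝ → ℝ → E}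
    (h : HBound T β A) (hdiag : ∀ s, 0 ≤ s → s ≤ T → A s s = 0) :
    ∃ C : ℝ, 0 ≤ C ∧ ∀ s t : ℝ, 0 ≤ s → s ≤ t → t ≤ T → ‖A s t‖ ≤ C * (t - s) ^ β := by
  obtain ⟨C, hC⟩ := h
  refine ⟨max C 0, le_max_right _ _, fun s t hs hst ht => ?_⟩
  have h0 : 0 ≤ (t - s) ^ β := Real.rpow_nonneg (by linarith) _
  rcases hst.eq_or_lt with rfl | hlt
  · rw [hdiag _ hs ht, norm_zero]; positivity
  · exact (hC s t hs hlt ht).trans (mul_le_mul_of_nonneg_right (le_max_left _ _) h0)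

section RoughIntegral

variable {V V2 W U : Type*}
  [NormedAddCommGroup V] [NormedSpace ℝ V] [NormedAddCommGroup V2] [NormedSpace ℝ V2]
  [NormedAddCommGroup W] [NormedSpace ℝ W] [NormedAddCommGroup U] [NormedSpace ℝ U]

theorem IsRoughPath.diag_eq_zero {T α : ℝ} {tmul : V →L[ℝ] V →L[ℝ] V2}
    {X : ℝ → V} {XX : ℝ → ℝ → V2} (hX : IsRoughPath T α tmul X XX) {s : ℝ} (hs : 0 ≤ s)
    (hsT : s ≤ T) : XX s s = 0 := by
  simpa using hX.chen s s s hs le_rfl le_rfl hsT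

/-- A Hölder path is bounded. -/
theorem exists_norm_le_of_holder {E : Type*} [NormedAddCommGroup E] {T α C : ℝ} (hT : 0 ≤ T)
    (hα : 0 ≤ α) (hC : 0 ≤ C) {A : ℝ → E}
    (h : ∀ s t : ℝ, 0 ≤ s → s ≤ t → t ≤ T → ‖A t - A s‖ ≤ C * (t - s) ^ α) :
    ∃ M : ℝ, 0 ≤ M ∧ ∀ s, 0 ≤ s → s ≤ T → ‖A s‖ ≤ M := by
  refine ⟨‖A 0‖ + C * T ^ α, by positivity, fun s hs hsT => ?_⟩
  have h1 := h 0 s le_rfl hs hsT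
  rw [sub_zero] at h1
  calc ‖A s‖ ≤ ‖A 0‖ + ‖A s - A 0‖ := norm_le_norm_add_norm_sub' _ _
    _ ≤ ‖A 0‖ + C * T ^ α := by gcongr; exact h1.trans (by gcongr)

theorem norm_clm_apply_le {E F : Type*} [NormedAddCommGroup E] [NormedSpace ℝ E]
    [NormedAddCommGroup F] [NormedSpace ℝ F] {f : E →L[ℝ] F} {x : E} {c d : ℝ}
    (hf : ‖f‖ ≤ c) (hx : ‖x‖ ≤ d) : ‖f x‖ ≤ c * d :=
  (f.le_opNorm x).trans (mul_le_mul hf hx (norm_nonneg _) ((norm_nonneg _).trans hf))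

/-- Expansion of the additivity defect of the compensated Riemann summand. -/
theorem summand_defect_eq (tops : TensorOps V V2 W U) {X : ℝ → V} {XX : ℝ → ℝ → V2}
    (Y : ℝ → W →L[ℝ] U) (Y' : ℝ → V →L[ℝ] (W →L[ℝ] U)) (Z : ℝ → W) (Z' : ℝ → V →L[ℝ] W)
    {s u t : ℝ} (hchen : XX s t = XX s u + XX u t + tops.tmul (X u - X s) (X t - X u)) :
    ((Y s) (Z t - Z s) + tops.spair (Y' s) (Z' s) (XX s t)) -
      ((Y s) (Z u - Z s) + tops.spair (Y' s) (Z' s) (XX s u)) -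
      ((Y u) (Z t - Z u) + tops.spair (Y' u) (Z' u) (XX u t)) =
    -(((Y' s (X u - X s)) ((Z' u - Z' s) (X t - X u)) +
      (Y' s (X u - X s)) (Rem X Z Z' u t) +
      (Rem X Y Y' s u) (Z t - Z u)) +
      tops.spair (Y' u - Y' s) (Z' u) (XX u t) +
      tops.spair (Y' s) (Z' u - Z' s) (XX u t)) := by
  rw [hchen]
  simp only [Rem, map_add, map_sub, tops.spair_tmul, sub_apply]
  abel

theorem exists_summand_defect_bound {T α : ℝ} (hT : 0 ≤ T) (hα : 0 < α)
    (tops : TensorOps V V2 W U) {X : ℝ → V} {XX : ℝ → ℝ → V2}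
    (hX : IsRoughPath T α tops.tmul X XX)
    {Y : ℝ → W →L[ℝ] U} {Y' : ℝ → V →L[ℝ] (W →L[ℝ] U)} (hY : IsCRP T α X Y Y')
    {Z : ℝ → W} {Z' : ℝ → V →L[ℝ] W} (hZ : IsCRP T α X Z Z') :
    ∃ C : ℝ, 0 ≤ C ∧ ∀ s u t : ℝ, 0 ≤ s → s ≤ u → u ≤ t → t ≤ T →
      ‖((Y s) (Z t - Z s) + tops.spair (Y' s) (Z' s) (XX s t)) -
      ((Y s) (Z u - Z s) + tops.spair (Y' s) (Z' s) (XX s u)) -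
      ((Y u) (Z t - Z u) + tops.spair (Y' u) (Z' u) (XX u t))‖ ≤ C * (t - s) ^ (3 * α) := by
  obtain ⟨c₁, hc₁, hx⟩ := hX.x_hold.exists_nonneg (by simp)
  obtain ⟨c₂, hc₂, hxx⟩ := hX.xx_hold.exists_nonneg (fun s hs hsT => hX.diag_eq_zero hs hsT)
  obtain ⟨c₃, hc₃, hy'⟩ := hY.deriv_hold.exists_nonneg (by simp)
  obtain ⟨c₄, hc₄, hry⟩ := hY.rem_hold.exists_nonneg (by simp [Rem])
  obtain ⟨c₅, hc₅, hz'⟩ := hZ.deriv_hold.exists_nonneg (by simp)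
  obtain ⟨c₆, hc₆, hrz⟩ := hZ.rem_hold.exists_nonneg (by simp [Rem])
  obtain ⟨M, hM, hYM⟩ := exists_norm_le_of_holder hT hα.le hc₃ hy'
  obtain ⟨N, hN, hZN⟩ := exists_norm_le_of_holder hT hα.le hc₅ hz'
  refine ⟨M * c₁ * (c₅ * c₁) + M * c₁ * c₆ + c₄ * (N * c₁ + c₆ * T ^ α) + c₃ * N * c₂ +
    M * c₅ * c₂, by positivity, fun s u t hs hsu hut htT => ?_⟩
  rw [summand_defect_eq tops Y Y' Z Z' (hX.chen s u t hs hsu hut htT), norm_neg]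
  have hu : 0 ≤ u := hs.trans hsu
  have huT : u ≤ T := hut.trans htT
  have hL : 0 ≤ t - s := by linarith
  set h := (t - s) ^ α with hh
  have hh0 : 0 ≤ h := Real.rpow_nonneg hL _
  have hhT : h ≤ T ^ α := Real.rpow_le_rpow hL (by linarith) hα.le
  have h2 : (t - s) ^ (2 * α) = h ^ 2 := by
    rw [hh, ← Real.rpow_mul_natCast hL]; push_cast; ring_nf
  have h3 : (t - s) ^ (3 * α) = h ^ 3 := by
    rw [hh, ← Real.rpow_mul_natCast hL]; push_cast; ring_nf
  have mono : ∀ {x y β c d : ℝ}, 0 ≤ β → 0 ≤ c → s ≤ x → x ≤ y → y ≤ t →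
      d ≤ c * (y - x) ^ β → d ≤ c * (t - s) ^ β := by
    intro x y β c d hβ hc hsx hxy hyt hd
    exact hd.trans (mul_le_mul_of_nonneg_left
      (Real.rpow_le_rpow (by linarith) (by linarith) hβ) hc)
  have h2α : 0 ≤ 2 * α := by linarith
  have bx1 := mono hα.le hc₁ le_rfl hsu hut (hx s u hs hsu huT)
  have bx2 := mono hα.le hc₁ hsu hut le_rfl (hx u t hu hut htT)
  have bxx := mono h2α hc₂ hsu hut le_rfl (hxx u t hu hut htT)
  have bdY := mono hα.le hc₃ le_rfl hsu hut (hy' s u hs hsu huT)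
  have bry := mono h2α hc₄ le_rfl hsu hut (hry s u hs hsu huT)
  have bdZ := mono hα.le hc₅ le_rfl hsu hut (hz' s u hs hsu huT)
  have brz := mono h2α hc₆ hsu hut le_rfl (hrz u t hu hut htT)
  have bY := hYM s hs (hsu.trans huT)
  have bZ := hZN u hu huT
  rw [h2] at bxx bry brz
  have bz : ‖Z t - Z u‖ ≤ (N * c₁ + c₆ * T ^ α) * h := by
    have e : Z t - Z u = Z' u (X t - X u) + Rem X Z Z' u t := by simp [Rem]
    rw [e]
    calc _ ≤ N * (c₁ * h) + c₆ * h ^ 2 := norm_add_le_of_le (norm_clm_apply_le bZ bx2) brz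
      _ = (N * c₁ + c₆ * h) * h := by ring
      _ ≤ _ := by gcongr
  have pair : ∀ {A : V →L[ℝ] (W →L[ℝ] U)} {B : V →L[ℝ] W} {x y : ℝ}, ‖A‖ ≤ x → ‖B‖ ≤ y →
      ‖tops.spair A B‖ ≤ x * y := by
    intro A B x y hA hB
    exact (tops.spair_le A B).trans
      (mul_le_mul hA hB (norm_nonneg B) ((norm_nonneg A).trans hA))
  have t1 := norm_clm_apply_le (norm_clm_apply_le bY bx1) (norm_clm_apply_le bdZ bx2)
  have t2 := norm_clm_apply_le (norm_clm_apply_le bY bx1) brz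
  have t3 := norm_clm_apply_le bry bz
  have t4 := norm_clm_apply_le (pair bdY bZ) bxx
  have t5 := norm_clm_apply_le (pair bY bdZ) bxx
  refine (norm_add_le_of_le (norm_add_le_of_le (norm_add_le_of_le (norm_add_le_of_le t1 t2) t3)
    t4) t5).trans_eq ?_
  rw [h3]
  ring

end RoughIntegral

/-- existence of the rough integral of a controlled rough path
against another controlled rough path. -/
theorem stmt4
    {V V2 W U : Type*} [NormedAddCommGroup V] [NormedSpace ℝ V] [CompleteSpace V]
    [NormedAddCommGroup V2] [NormedSpace ℝ V2] [CompleteSpace V2]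
    [NormedAddCommGroup W] [NormedSpace ℝ W] [CompleteSpace W]
    [NormedAddCommGroup U] [NormedSpace ℝ U] [CompleteSpace U]
    (T α : ℝ) (hT : 0 < T) (hα : 1 / 3 < α) (hα' : α ≤ 1 / 2)
    (tops : TensorOps V V2 W U) (X : ℝ → V) (XX : ℝ → ℝ → V2)
    (hX : IsRoughPath T α tops.tmul X XX)
    (Y : ℝ → W →L[ℝ] U) (Y' : ℝ → V →L[ℝ] (W →L[ℝ] U)) (hY : IsCRP T α X Y Y')
    (Z : ℝ → W) (Z' : ℝ → V →L[ℝ] W) (hZ : IsCRP T α X Z Z') :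
    ∀ s t : ℝ, 0 ≤ s → s ≤ t → t ≤ T →
      ∃ I : U, IsRoughIntegral tops XX Y Y' Z Z' s t I := by
  intro s t hs hst ht
  obtain ⟨C, hC, hdefect⟩ := exists_summand_defect_bound hT.le (by linarith) tops hX hY hZ
  exact exists_tendsto_sum_of_almost_additive
    (Ξ := fun x y => Y x (Z y - Z x) + tops.spair (Y' x) (Z' x) (XX x y)) hst hC
    (by linarith : 1 < 3 * α)
    (fun x hx hxt => by simp [hX.diag_eq_zero (hs.trans hx) (hxt.trans ht)])
    (fun x y z hx hxy hyz hz => hdefect x y z (hs.trans hx) hxy hyz (hz.trans ht))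
end
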